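/- In the setting of the covering lemma for the class 𝒬 (functions Q(s,a) = min(wᵀφ(s,a) + v + β√(φ(s,a)ᵀΛ⁻¹φ(s,a)), M) with ‖w‖₂ ≤ L, β ∈ [0,B], v ∈ [0,D], Λ symmetric positive definite with λ_min(Λ) ≥ λ > 0, and ‖φ(s,a)‖₂ ≤ 1), let 𝒱 be the class of all functions V : S → ℝ of the form V(s) = max_{a∈A} Clip( Q₁(s,a); max(Q₂(s,a), Q₃(s,a)), min(Q₄(s,a), Q₅(s,a)) ) where Q₁, …, Q₅ ∈ 𝒬 and A is a nonempty finite set. Then for every ε > 0 there exists a finite set C of functions from S to ℝ such that every V ∈ 𝒱 has some V' ∈ C with sup_s |V(s) − V'(s)| ≤ ε, and log|C| ≤ 5d·log(1 + 8L/ε) + 5·log(1 + 8D/ε) + 5d²·log(1 + 8√d·B²/(λε²)). -/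

import Mathlib

open Matrix Finset

/-- `Clip(x; L, U) = min (max x L) U`. -/
noncomputable def clip (x L U : ℝ) : ℝ := min (max x L) U

/-- Membership in the parametric class `𝒬` of optimistic action-value functions
`Q(s,a) = min(wᵀφ(s,a) + v + β√(φ(s,a)ᵀΛ⁻¹φ(s,a)), M)` with `‖w‖₂ ≤ L`, `β ∈ [0,B]`,
`v ∈ [0,D]` and `Λ` symmetric with `λ_min(Λ) ≥ λ`. -/
def memQ {S A : Type*} (d : ℕ) (φ : S → A → Fin d → ℝ) (M L B D lam : ℝ)
    (Q : S → A → ℝ) : Prop :=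
  ∃ (w : Fin d → ℝ) (β v : ℝ) (Λ : Matrix (Fin d) (Fin d) ℝ),
    Real.sqrt (∑ j, w j ^ 2) ≤ L ∧ β ∈ Set.Icc 0 B ∧ v ∈ Set.Icc 0 D ∧
    Λ.IsSymm ∧ (∀ x : Fin d → ℝ, lam * (x ⬝ᵥ x) ≤ x ⬝ᵥ (Λ *ᵥ x)) ∧
    ∀ s a, Q s a = min (w ⬝ᵥ φ s a + v + β * Real.sqrt (φ s a ⬝ᵥ (Λ⁻¹ *ᵥ φ s a))) M

open MeasureTheory Metric Module in
open scoped Function ENNReal in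
/-- A `δ`-separated set in the ball of radius `R` of a finite-dimensional normed space has
cardinality at most `(1 + 2R/δ) ^ dim`. -/
theorem card_le_pow_of_separated {E : Type*} [NormedAddCommGroup E] [NormedSpace ℝ E]
    [FiniteDimensional ℝ E] {R δ : ℝ} (hR : 0 ≤ R) (hδ : 0 < δ) (s : Finset E)
    (hs : ∀ c ∈ s, ‖c‖ ≤ R) (h : ∀ c ∈ s, ∀ c' ∈ s, c ≠ c' → δ ≤ ‖c - c'‖) :
    (s.card : ℝ) ≤ (1 + 2 * R / δ) ^ finrank ℝ E := by
  borelize E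
  let μ : Measure E := Measure.addHaar
  have ρpos : 0 < R + δ / 2 := by positivity
  have hdisj : Set.Pairwise (s : Set E) (Disjoint on fun c => ball (c : E) (δ / 2)) := by
    rintro c hc c' hc' hcc
    apply ball_disjoint_ball
    rw [dist_eq_norm, add_halves]
    exact h c hc c' hc' hcc
  have hsub : (⋃ c ∈ s, ball (c : E) (δ / 2)) ⊆ ball (0 : E) (R + δ / 2) := by
    refine Set.iUnion₂_subset fun x hx => ball_subset_ball' ?_
    rw [dist_zero_right]
    linarith [hs x hx]
  have I : (s.card : ℝ≥0∞) * ENNReal.ofReal ((δ / 2) ^ finrank ℝ E) * μ (ball 0 1) ≤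
      ENNReal.ofReal ((R + δ / 2) ^ finrank ℝ E) * μ (ball 0 1) :=
    calc
      _ = μ (⋃ c ∈ s, ball (c : E) (δ / 2)) := by
        rw [measure_biUnion_finset hdisj fun c _ => measurableSet_ball]
        simp only [μ.addHaar_ball_of_pos _ (half_pos hδ), Finset.sum_const, nsmul_eq_mul, mul_assoc]
      _ ≤ μ (ball (0 : E) (R + δ / 2)) := measure_mono hsub
      _ = _ := μ.addHaar_ball_of_pos _ ρpos
  have J := (ENNReal.mul_le_mul_iff_left (measure_ball_pos _ _ zero_lt_one).ne'
    measure_ball_lt_top.ne).1 I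
  have K := ENNReal.toReal_le_of_le_ofReal (by positivity) J
  rw [ENNReal.toReal_mul, ENNReal.toReal_natCast, ENNReal.toReal_ofReal (by positivity),
    ← le_div_iff₀ (by positivity), ← div_pow] at K
  refine K.trans_eq ?_
  congr 1
  field_simp
  ring

open Module in
/-- The ball of radius `R` of a finite-dimensional normed space has a `δ`-net of cardinality at most
`(1 + 2R/δ) ^ dim`. -/
theorem exists_finset_net {E : Type*} [NormedAddCommGroup E] [NormedSpace ℝ E]
    [FiniteDimensional ℝ E] {R δ : ℝ} (hR : 0 ≤ R) (hδ : 0 < δ) :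
    ∃ s : Finset E, (∀ x, ‖x‖ ≤ R → ∃ c ∈ s, ‖x - c‖ ≤ δ) ∧
      (s.card : ℝ) ≤ (1 + 2 * R / δ) ^ finrank ℝ E := by
  classical
  let T : Set ℕ := {n | ∃ s : Finset E, s.card = n ∧ (∀ c ∈ s, ‖c‖ ≤ R) ∧
    ∀ c ∈ s, ∀ c' ∈ s, c ≠ c' → δ ≤ ‖c - c'‖}
  have hbdd : BddAbove T := by
    refine ⟨⌊(1 + 2 * R / δ) ^ finrank ℝ E⌋₊, ?_⟩
    rintro _ ⟨s, rfl, h₁, h₂⟩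
    exact Nat.le_floor (card_le_pow_of_separated hR hδ s h₁ h₂)
  obtain ⟨s, hcard, h₁, h₂⟩ := Nat.sSup_mem (s := T) ⟨0, ∅, by simp⟩ hbdd
  refine ⟨s, fun x hx => ?_, card_le_pow_of_separated hR hδ s h₁ h₂⟩
  by_contra! hfar
  have hxs : x ∉ s := fun hmem => by
    have := hfar x hmem
    simp only [sub_self, norm_zero] at this
    linarith
  have hmem : (insert x s).card ∈ T := by
    refine ⟨insert x s, rfl, ?_, ?_⟩
    · intro c hc
      rcases Finset.mem_insert.1 hc with rfl | hc
      exacts [hx, h₁ c hc]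
    · intro c hc c' hc' hne
      rcases Finset.mem_insert.1 hc with rfl | hcs <;> rcases Finset.mem_insert.1 hc' with rfl | hcs'
      · exact absurd rfl hne
      · exact (hfar c' hcs').le
      · rw [norm_sub_rev]; exact (hfar c hcs).le
      · exact h₂ c hcs c' hcs' hne
  have := le_csSup hbdd hmem
  rw [Finset.card_insert_of_notMem hxs] at this
  omega

theorem abs_sqrt_sub_sqrt_le (x y : ℝ) : |√x - √y| ≤ √|x - y| := by
  wlog h : y ≤ x generalizing x y
  · rw [abs_sub_comm, abs_sub_comm x y]
    exact this y x (le_of_not_ge h)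
  rw [abs_of_nonneg (sub_nonneg.2 (Real.sqrt_le_sqrt h)), abs_of_nonneg (sub_nonneg.2 h),
    sub_le_iff_le_add]
  refine Real.sqrt_le_iff.2 ⟨by positivity, ?_⟩
  have h₁ := Real.sq_sqrt (sub_nonneg.2 h)
  have h₂ : y ≤ √y ^ 2 := by
    rcases le_total 0 y with hy | hy
    · exact (Real.sq_sqrt hy).ge
    · exact hy.trans (sq_nonneg _)
  nlinarith [mul_nonneg (Real.sqrt_nonneg (x - y)) (Real.sqrt_nonneg y)]

theorem abs_dotProduct_le {n : Type*} [Fintype n] (u v : n → ℝ) :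
    |u ⬝ᵥ v| ≤ √(∑ i, u i ^ 2) * √(∑ i, v i ^ 2) := by
  rw [← Real.sqrt_mul (by positivity)]
  exact Real.abs_le_sqrt (Finset.sum_mul_sq_le_sq_mul_sq _ _ _)

theorem abs_quadratic_form_le {n : Type*} [Fintype n] (A : Matrix n n ℝ) (u : n → ℝ)
    (hu : √(∑ i, u i ^ 2) ≤ 1) :
    |u ⬝ᵥ (A *ᵥ u)| ≤ √(∑ p : n × n, A p.1 p.2 ^ 2) := by
  have h : u ⬝ᵥ (A *ᵥ u) = (fun p : n × n => A p.1 p.2) ⬝ᵥ (fun p => u p.1 * u p.2) := by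
    simp only [dotProduct, mulVec, Fintype.sum_prod_type, Finset.mul_sum]
    exact Finset.sum_congr rfl fun i _ => Finset.sum_congr rfl fun j _ => by ring
  have h' : ∑ p : n × n, (u p.1 * u p.2) ^ 2 = (∑ i, u i ^ 2) ^ 2 := by
    simp only [Fintype.sum_prod_type, mul_pow, sq (∑ i, u i ^ 2), Finset.sum_mul_sum]
  rw [h]
  refine (abs_dotProduct_le _ _).trans (mul_le_of_le_one_right (Real.sqrt_nonneg _) ?_)
  rw [h', Real.sqrt_sq (by positivity)]
  simpa using hu

/-- If `x ⬝ Λx ≥ λ |x|²` for all `x`, then `‖Λ⁻¹‖_F ≤ √d / λ`. -/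
theorem sqrt_sum_inv_sq_le {d : ℕ} {lam : ℝ} (hlam : 0 < lam) {Λ : Matrix (Fin d) (Fin d) ℝ}
    (hΛ : ∀ x : Fin d → ℝ, lam * (x ⬝ᵥ x) ≤ x ⬝ᵥ (Λ *ᵥ x)) :
    √(∑ p : Fin d × Fin d, Λ⁻¹ p.1 p.2 ^ 2) ≤ √d / lam := by
  have hunit : IsUnit Λ := by
    rw [← Matrix.mulVec_injective_iff_isUnit]
    refine (injective_iff_map_eq_zero Λ.mulVecLin).2 fun x hx => ?_
    have h := hΛ x
    rw [show Λ *ᵥ x = 0 from hx, dotProduct_zero] at h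
    have h0 : x ⬝ᵥ x = 0 :=
      le_antisymm (nonpos_of_mul_nonpos_right h hlam) (Finset.sum_nonneg fun _ _ => mul_self_nonneg _)
    exact dotProduct_self_eq_zero.1 h0
  have hcol (j : Fin d) : ∑ i, Λ⁻¹ i j ^ 2 ≤ 1 / lam ^ 2 := by
    set y : Fin d → ℝ := fun i => Λ⁻¹ i j
    have hy : Λ *ᵥ y = Pi.single j 1 := by
      have : y = Λ⁻¹ *ᵥ Pi.single j 1 := by ext i; simp [y]
      rw [this, Matrix.mulVec_mulVec,
        Matrix.mul_nonsing_inv _ ((Matrix.isUnit_iff_isUnit_det _).1 hunit),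
        Matrix.one_mulVec]
    have h := hΛ y
    rw [hy, dotProduct_single, mul_one] at h
    have hsum : y ⬝ᵥ y = ∑ i, y i ^ 2 := by simp [dotProduct, sq]
    rw [hsum] at h
    have hj : y j ^ 2 ≤ ∑ i, y i ^ 2 :=
      Finset.single_le_sum (f := fun i => y i ^ 2) (fun _ _ => sq_nonneg _) (Finset.mem_univ j)
    change ∑ i, y i ^ 2 ≤ _
    set q := ∑ i, y i ^ 2
    rw [le_div_iff₀ (by positivity)]
    have hq : 0 ≤ q := (sq_nonneg _).trans hj
    have hsq : (lam * q) ^ 2 ≤ q :=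
      (pow_le_pow_left₀ (by positivity) h 2).trans hj
    rcases hq.eq_or_lt with h0 | hpos
    · rw [← h0]; simp
    · refine le_of_mul_le_mul_left ?_ hpos
      linarith [hsq]
  rw [Real.sqrt_le_left (by positivity), div_pow, Real.sq_sqrt (by positivity),
    Fintype.sum_prod_type_right]
  calc _ ≤ ∑ _j : Fin d, 1 / lam ^ 2 := Finset.sum_le_sum fun j _ => hcol j
    _ = d / lam ^ 2 := by simp [div_eq_mul_inv]

/-- The class `𝒬` has a sup-norm `ε`-cover of the standard cardinality. -/
theorem exists_finset_cover_memQ {S A : Type*} (d : ℕ)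
    (φ : S → A → Fin d → ℝ) (hφ : ∀ s a, Real.sqrt (∑ j, φ s a j ^ 2) ≤ 1)
    (M L B D lam ε : ℝ) (hL : 0 ≤ L) (hD : 0 ≤ D) (hlam : 0 < lam) (hε : 0 < ε) :
    ∃ N : Finset (S → A → ℝ),
      (∀ Q, memQ d φ M L B D lam Q → ∃ Q' ∈ N, ∀ s a, |Q s a - Q' s a| ≤ ε) ∧
      (N.card : ℝ) ≤ (1 + 8 * L / ε) ^ d * (1 + 8 * D / ε) *
        (1 + 8 * Real.sqrt d * B ^ 2 / (lam * ε ^ 2)) ^ d ^ 2 := by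
  classical
  obtain ⟨W, hW, hWc⟩ := exists_finset_net (E := EuclideanSpace ℝ (Fin d)) hL
    (show 0 < ε / 4 by positivity)
  obtain ⟨U, hU, hUc⟩ := exists_finset_net (E := ℝ) hD (show 0 < ε / 4 by positivity)
  obtain ⟨G, hG, hGc⟩ := exists_finset_net (E := EuclideanSpace ℝ (Fin d × Fin d))
    (show 0 ≤ B ^ 2 * (√d / lam) by positivity) (show 0 < ε ^ 2 / 4 by positivity)
  let F : EuclideanSpace ℝ (Fin d) × ℝ × EuclideanSpace ℝ (Fin d × Fin d) → S → A → ℝ :=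
    fun p s a => min (p.1.ofLp ⬝ᵥ φ s a + p.2.1 +
      √(φ s a ⬝ᵥ ((Matrix.of fun i j => p.2.2 (i, j)) *ᵥ φ s a))) M
  refine ⟨(W ×ˢ U ×ˢ G).image F, ?_, ?_⟩
  · rintro Q ⟨w, β, v, Λ, hw, hβ, hv, -, hΛ, hQ⟩
    obtain ⟨w', hw', hww⟩ := hW (WithLp.toLp 2 w) (by simpa [EuclideanSpace.norm_eq] using hw)
    obtain ⟨v', hv', hvv⟩ := hU v (by rw [Real.norm_eq_abs, abs_of_nonneg hv.1]; exact hv.2)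
    obtain ⟨g, hg, hgg⟩ := hG (WithLp.toLp 2 fun p => β ^ 2 * Λ⁻¹ p.1 p.2) (by
      have hβB : β ^ 2 ≤ B ^ 2 := pow_le_pow_left₀ hβ.1 hβ.2 2
      simp only [EuclideanSpace.norm_eq, Real.norm_eq_abs, sq_abs, mul_pow (β ^ 2),
        ← Finset.mul_sum]
      rw [Real.sqrt_mul (by positivity), Real.sqrt_sq (by positivity)]
      exact mul_le_mul hβB (sqrt_sum_inv_sq_le hlam hΛ) (by positivity) (by positivity))
    refine ⟨F (w', v', g), Finset.mem_image_of_mem _ (by simp [hw', hv', hg]), fun s a => ?_⟩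
    rw [hQ]
    refine (abs_min_sub_min_le_max _ _ _ _).trans (max_le ?_ (by simpa using hε.le))
    set f := φ s a
    have e₁ : |(w - w'.ofLp) ⬝ᵥ f| ≤ ε / 4 := by
      refine (abs_dotProduct_le _ _).trans
        ((mul_le_of_le_one_right (Real.sqrt_nonneg _) (hφ s a)).trans ?_)
      simpa [EuclideanSpace.norm_eq] using hww
    have e₂ : |v - v'| ≤ ε / 4 := hvv
    have e₃ : |β * √(f ⬝ᵥ (Λ⁻¹ *ᵥ f)) -
        √(f ⬝ᵥ ((Matrix.of fun i j => g (i, j)) *ᵥ f))| ≤ ε / 2 := by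
      have hβs : β * √(f ⬝ᵥ (Λ⁻¹ *ᵥ f)) = √(f ⬝ᵥ ((β ^ 2 • Λ⁻¹) *ᵥ f)) := by
        rw [Matrix.smul_mulVec, dotProduct_smul, smul_eq_mul, Real.sqrt_mul (sq_nonneg _),
          Real.sqrt_sq hβ.1]
      rw [hβs]
      refine (abs_sqrt_sub_sqrt_le _ _).trans ?_
      rw [← dotProduct_sub, ← Matrix.sub_mulVec, Real.sqrt_le_left (by positivity)]
      refine (abs_quadratic_form_le _ _ (hφ s a)).trans ?_
      refine le_trans ?_ (hgg.trans_eq (by ring))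
      simp [EuclideanSpace.norm_eq]
    rw [sub_dotProduct] at e₁
    change |w ⬝ᵥ f + v + β * √(f ⬝ᵥ (Λ⁻¹ *ᵥ f)) -
      (w'.ofLp ⬝ᵥ f + v' + √(f ⬝ᵥ ((Matrix.of fun i j => g (i, j)) *ᵥ f)))| ≤ ε
    rw [abs_le] at e₁ e₂ e₃ ⊢
    constructor <;> linarith [e₁.1, e₁.2, e₂.1, e₂.2, e₃.1, e₃.2]
  · have hle : (((W ×ˢ U ×ˢ G).image F).card : ℝ) ≤ W.card * (U.card * G.card) := by
      have := Finset.card_image_le (s := W ×ˢ U ×ˢ G) (f := F)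
      rw [Finset.card_product, Finset.card_product] at this
      exact_mod_cast this
    refine hle.trans ?_
    rw [← mul_assoc]
    have r₁ (x : ℝ) : 2 * x / (ε / 4) = 8 * x / ε := by field_simp; ring
    have r₂ : 2 * (B ^ 2 * (√d / lam)) / (ε ^ 2 / 4) = 8 * √d * B ^ 2 / (lam * ε ^ 2) := by
      field_simp; ring
    simp only [finrank_euclideanSpace, Fintype.card_fin, r₁] at hWc
    simp only [Module.finrank_self, pow_one, r₁] at hUc
    simp only [finrank_euclideanSpace, Fintype.card_prod, Fintype.card_fin, r₂, ← sq] at hGc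
    gcongr

theorem abs_sup'_sub_sup'_le {ι : Type*} {s : Finset ι} (hs : s.Nonempty) {f g : ι → ℝ} {ε : ℝ}
    (h : ∀ i ∈ s, |f i - g i| ≤ ε) : |s.sup' hs f - s.sup' hs g| ≤ ε := by
  rw [abs_sub_le_iff, sub_le_iff_le_add, sub_le_iff_le_add]
  constructor <;> refine Finset.sup'_le _ _ fun i hi => ?_
  · linarith [(abs_le.1 (h i hi)).2, Finset.le_sup' g hi]
  · linarith [(abs_le.1 (h i hi)).1, Finset.le_sup' f hi]

theorem abs_clip_sub_clip_le {x L U x' L' U' ε : ℝ} (hx : |x - x'| ≤ ε) (hL : |L - L'| ≤ ε)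
    (hU : |U - U'| ≤ ε) : |clip x L U - clip x' L' U'| ≤ ε :=
  (abs_min_sub_min_le_max _ _ _ _).trans
    (max_le ((abs_max_sub_max_le_max _ _ _ _).trans (max_le hx hL)) hU)

/-- Covering number of the class `𝒱` of clipped state-value functions
`V(s) = max_{a} Clip(Q₁(s,a); max(Q₂(s,a), Q₃(s,a)), min(Q₄(s,a), Q₅(s,a)))` with
`Q₁, …, Q₅ ∈ 𝒬`: there is a sup-norm `ε`-cover `C` with
`log|C| ≤ 5d·log(1 + 8L/ε) + 5·log(1 + 8D/ε) + 5d²·log(1 + 8√d·B²/(λε²))`. -/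
theorem stmt_9 {S A : Type*} [Nonempty S] [Fintype A] [Nonempty A] (d : ℕ) (hd : 1 ≤ d)
    (φ : S → A → Fin d → ℝ) (hφ : ∀ s a, Real.sqrt (∑ j, φ s a j ^ 2) ≤ 1)
    (M L B D lam ε : ℝ) (hM : 0 < M) (hL : 0 < L) (hB : 0 < B) (hD : 0 < D)
    (hlam : 0 < lam) (hε : 0 < ε) :
    ∃ C : Finset (S → ℝ),
      (∀ V : S → ℝ,
        (∃ Q1 Q2 Q3 Q4 Q5 : S → A → ℝ,
          memQ d φ M L B D lam Q1 ∧ memQ d φ M L B D lam Q2 ∧ memQ d φ M L B D lam Q3 ∧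
          memQ d φ M L B D lam Q4 ∧ memQ d φ M L B D lam Q5 ∧
          ∀ s, V s = Finset.univ.sup' Finset.univ_nonempty (fun a =>
            clip (Q1 s a) (max (Q2 s a) (Q3 s a)) (min (Q4 s a) (Q5 s a)))) →
        ∃ V' ∈ C, ∀ s, |V s - V' s| ≤ ε) ∧
      Real.log C.card ≤ 5 * d * Real.log (1 + 8 * L / ε) + 5 * Real.log (1 + 8 * D / ε) +
        5 * d ^ 2 * Real.log (1 + 8 * Real.sqrt d * B ^ 2 / (lam * ε ^ 2)) := by
  classical
  obtain ⟨N, hN, hcard⟩ :=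
    exists_finset_cover_memQ d φ hφ M L B D lam ε hL.le hD.le hlam hε
  let G : (S → A → ℝ) × (S → A → ℝ) × (S → A → ℝ) × (S → A → ℝ) × (S → A → ℝ) → S → ℝ :=
    fun q s => Finset.univ.sup' Finset.univ_nonempty fun a =>
      clip (q.1 s a) (max (q.2.1 s a) (q.2.2.1 s a)) (min (q.2.2.2.1 s a) (q.2.2.2.2 s a))
  refine ⟨(N ×ˢ N ×ˢ N ×ˢ N ×ˢ N).image G, ?_, ?_⟩
  · rintro V ⟨Q1, Q2, Q3, Q4, Q5, h1, h2, h3, h4, h5, hV⟩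
    obtain ⟨R1, m1, e1⟩ := hN Q1 h1
    obtain ⟨R2, m2, e2⟩ := hN Q2 h2
    obtain ⟨R3, m3, e3⟩ := hN Q3 h3
    obtain ⟨R4, m4, e4⟩ := hN Q4 h4
    obtain ⟨R5, m5, e5⟩ := hN Q5 h5
    refine ⟨G (R1, R2, R3, R4, R5), Finset.mem_image_of_mem _ (by simp [m1, m2, m3, m4, m5]),
      fun s => ?_⟩
    rw [hV]
    exact abs_sup'_sub_sup'_le _ fun a _ => abs_clip_sub_clip_le (e1 s a)
      ((abs_max_sub_max_le_max _ _ _ _).trans (max_le (e2 s a) (e3 s a)))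
      ((abs_min_sub_min_le_max _ _ _ _).trans (max_le (e4 s a) (e5 s a)))
  · have hL' : 1 ≤ 1 + 8 * L / ε := le_add_of_nonneg_right (by positivity)
    have hD' : 1 ≤ 1 + 8 * D / ε := le_add_of_nonneg_right (by positivity)
    have hB' : 1 ≤ 1 + 8 * Real.sqrt d * B ^ 2 / (lam * ε ^ 2) :=
      le_add_of_nonneg_right (by positivity)
    set C := (N ×ˢ N ×ˢ N ×ˢ N ×ˢ N).image G
    set a := 1 + 8 * L / ε
    set b := 1 + 8 * D / ε
    set c := 1 + 8 * Real.sqrt d * B ^ 2 / (lam * ε ^ 2)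
    have ha0 : 0 < a := by linarith
    have hb0 : 0 < b := by linarith
    have hc0 : 0 < c := by linarith
    have hC : (C.card : ℝ) ≤ (a ^ d * b * c ^ d ^ 2) ^ 5 := by
      have h : C.card ≤ N.card ^ 5 := by
        refine Finset.card_image_le.trans_eq ?_
        simp only [Finset.card_product]
        ring
      calc (C.card : ℝ) ≤ (N.card : ℝ) ^ 5 := by exact_mod_cast h
        _ ≤ _ := by gcongr
    have hlog : Real.log ((a ^ d * b * c ^ d ^ 2) ^ 5) =
        5 * d * Real.log a + 5 * Real.log b + 5 * d ^ 2 * Real.log c := by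
      rw [Real.log_pow, Real.log_mul (by positivity) (by positivity),
        Real.log_mul (by positivity) (by positivity), Real.log_pow, Real.log_pow]
      push_cast
      ring
    rw [← hlog]
    rcases Nat.eq_zero_or_pos C.card with h0 | hpos
    · rw [h0, Nat.cast_zero, Real.log_zero]
      exact Real.log_nonneg (one_le_pow₀
        (one_le_mul_of_one_le_of_one_le (one_le_mul_of_one_le_of_one_le (one_le_pow₀ hL') hD')
          (one_le_pow₀ hB')))
    · exact Real.log_le_log (by exact_mod_cast hpos) hC
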